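/- Let N be an odd positive integer, let u be an integer coprime to N, and define the Zadoff–Chu sequence x_n = exp(−πi u n(n+1)/N) for n ∈ ℤ. Then x is N-periodic, and for every integer shift k with k ≢ 0 (mod N), the periodic autocorrelation vanishes: Σ_{n=0}^{N−1} x_n · conj(x_{n+k}) = 0; moreover Σ_{n=0}^{N−1} x_n · conj(x_n) = N. -/

import Mathlib

open Complex Finset

/-- Zadoff–Chu sequences of odd length `N` with root `u` coprime to `N` are
`N`-periodic and have ideal periodic autocorrelation: the autocorrelation at any
shift `k ≢ 0 (mod N)` vanishes, and at shift `0` it equals `N`. -/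
theorem stmt8 (N : ℕ) (hN : 0 < N) (hodd : Odd N) (u : ℤ) (hu : IsCoprime u (N : ℤ))
    (x : ℤ → ℂ)
    (hx : ∀ n : ℤ, x n =
      Complex.exp (-(Real.pi : ℂ) * Complex.I * (u : ℂ) * (n : ℂ) * ((n : ℂ) + 1) / (N : ℂ))) :
    (∀ n : ℤ, x (n + N) = x n) ∧
    (∀ k : ℤ, ¬ ((N : ℤ) ∣ k) →
      ∑ n ∈ Finset.range N, x n * (starRingEnd ℂ) (x (n + k)) = 0) ∧
    ∑ n ∈ Finset.range N, x n * (starRingEnd ℂ) (x n) = (N : ℂ) := by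
  have hN0 : (N : ℂ) ≠ 0 := by exact_mod_cast hN.ne'
  have hconj : ∀ n : ℤ, (starRingEnd ℂ) (x n) =
      Complex.exp ((Real.pi : ℂ) * Complex.I * (u : ℂ) * (n : ℂ) * ((n : ℂ) + 1) / (N : ℂ)) := by
    intro n
    rw [hx, ← Complex.exp_conj]
    congr 1
    simp [Complex.conj_ofReal]
  refine ⟨?_, ?_, ?_⟩
  · intro n
    obtain ⟨m, hm⟩ := hodd
    rw [hx, hx, Complex.exp_eq_exp_iff_exists_int]
    refine ⟨-(u * (n + m + 1)), ?_⟩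
    have hm' : (N : ℂ) = 2 * m + 1 := by exact_mod_cast hm
    push_cast
    field_simp
    rw [hm']
    ring
  · intro k hk
    set z : ℂ := Complex.exp (2 * Real.pi * Complex.I * u * k / N) with hz
    have hz1 : z ≠ 1 := by
      intro h
      rw [hz, Complex.exp_eq_one_iff] at h
      obtain ⟨m, hm⟩ := h
      have h2 : (2 * (Real.pi : ℂ) * Complex.I) ≠ 0 := Complex.two_pi_I_ne_zero
      have h3 : (u : ℂ) * k = m * N := by
        apply mul_left_cancel₀ h2
        field_simp at hm
        linear_combination (2 * (Real.pi : ℂ) * Complex.I) * hm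
      have h4 : u * k = m * N := by exact_mod_cast h3
      exact hk (hu.symm.dvd_of_dvd_mul_left ⟨m, by rw [h4]; ring⟩)
    have hzN : z ^ N = 1 := by
      rw [hz, ← Complex.exp_nat_mul, Complex.exp_eq_one_iff]
      refine ⟨u * k, ?_⟩
      push_cast
      field_simp
    have hterm : ∀ n ∈ Finset.range N, x n * (starRingEnd ℂ) (x (n + k)) =
        Complex.exp (Real.pi * Complex.I * u * k * (k + 1) / N) * z ^ n := by
      intro n _
      rw [hconj, hx, hz, ← Complex.exp_nat_mul, ← Complex.exp_add, ← Complex.exp_add]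
      congr 1
      push_cast
      field_simp
      ring
    rw [Finset.sum_congr rfl hterm, ← Finset.mul_sum, geom_sum_eq hz1, hzN]
    simp
  · have hterm : ∀ n ∈ Finset.range N, x n * (starRingEnd ℂ) (x n) = 1 := by
      intro n _
      rw [hconj, hx, ← Complex.exp_add, ← Complex.exp_zero]
      congr 1
      ring
    rw [Finset.sum_congr rfl hterm]
    simp
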